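/- For any fixed positive integer k, almost surely Π_{X,X+k}(x) ~ x/(log x)^2 as x → ∞; that is, for ℙ-almost every realization α of the Hawkins random sieve, the number of m ≤ x with both m ∈ α and m + k ∈ α is asymptotic to x/(log x)^2. -/

import Mathlib

open MeasureTheory Filter Finset Asymptotics
open scoped Classical

/-- `y_m(α) = ∏_{j ∈ α, j < m} (1 - 1/j)` (empty product = 1). -/
noncomputable def hawkinsY (A : Set ℕ) (m : ℕ) : ℝ :=
  ∏ j ∈ Finset.range m, if j ∈ A then 1 - 1 / (j : ℝ) else 1

/-- The σ-algebra generated by the events `{j ∈ α}` for `2 ≤ j < m`. -/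
def sieveSigma {Ω : Type*} (α : Ω → Set ℕ) (m : ℕ) : MeasurableSpace Ω :=
  MeasurableSpace.generateFrom {s | ∃ j : ℕ, 2 ≤ j ∧ j < m ∧ s = {ω | j ∈ α ω}}

/-- Wunderlich's model of the Hawkins random sieve: a probability space `(Ω, μ)` with a
random subset `α` of `{2,3,4,…}` such that `μ(2 ∈ α) = 1` and, for every `m ≥ 2`, the
conditional probability of `{m ∈ α}` given the σ-algebra generated by the events
`{j ∈ α}`, `2 ≤ j < m`, equals `y_m(α)`. -/
structure IsHawkinsSieve {Ω : Type*} [MeasurableSpace Ω] (μ : Measure Ω)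
    (α : Ω → Set ℕ) : Prop where
  isProb : IsProbabilityMeasure μ
  meas : ∀ n : ℕ, MeasurableSet {ω | n ∈ α ω}
  mem_ge_two : ∀ ω, ∀ n ∈ α ω, 2 ≤ n
  two_mem : μ {ω | 2 ∈ α ω} = 1
  condExp_mem : ∀ m : ℕ, 2 ≤ m →
    μ[Set.indicator {ω | m ∈ α ω} (fun _ => (1 : ℝ)) | sieveSigma α m]
      =ᵐ[μ] fun ω => hawkinsY (α ω) m

/-- `M_k = 1 + ∑_{j=1}^{k-2} 1/j` (so `M_2 = 1`). -/
noncomputable def Mharm (k : ℕ) : ℝ := 1 + ∑ j ∈ Finset.Icc 1 (k - 2), 1 / (j : ℝ)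

/-- `Π_{X,X+k}(x; α)`: the number of `m ≤ x` with `m ∈ α` and `m + k ∈ α`. -/
noncomputable def piTwin (A : Set ℕ) (k x : ℕ) : ℕ :=
  ((Finset.range (x + 1)).filter fun m => m ∈ A ∧ m + k ∈ A).card

/-- A process with bounded increments of vanishing conditional mean and summable variances
converges almost surely. -/
theorem ae_exists_tendsto_sum_of_condExp_eq_zero {Ω : Type*} [m0 : MeasurableSpace Ω]
    {μ : Measure Ω} [IsProbabilityMeasure μ] (𝒢 : Filtration ℕ m0) {D : ℕ → Ω → ℝ}
    (hmeas : ∀ i, StronglyMeasurable[𝒢 (i + 1)] (D i))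
    (hbdd : ∀ i, ∃ C, ∀ ω, |D i ω| ≤ C)
    (hzero : ∀ i, μ[D i | 𝒢 i] =ᵐ[μ] 0)
    (hsum : Summable fun i => ∫ ω, D i ω ^ 2 ∂μ) :
    ∀ᵐ ω ∂μ, ∃ l : ℝ, Tendsto (fun n => ∑ i ∈ range n, D i ω) atTop (nhds l) := by
  set S : ℕ → Ω → ℝ := fun n ω => ∑ i ∈ range n, D i ω with hS
  have hS_succ : ∀ n, S (n + 1) = S n + D n := fun n => by
    ext ω; simp [hS, sum_range_succ]
  have hSm : StronglyAdapted 𝒢 S := by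
    intro n
    induction n with
    | zero => simpa [hS] using stronglyMeasurable_const
    | succ n ih => rw [hS_succ]; exact (ih.mono (𝒢.mono n.le_succ)).add (hmeas n)
  have hSb : ∀ n, ∃ C, ∀ ω, |S n ω| ≤ C := by
    intro n
    induction n with
    | zero => exact ⟨0, fun ω => by simp [hS]⟩
    | succ n ih =>
      obtain ⟨C, hC⟩ := ih
      obtain ⟨C', hC'⟩ := hbdd n
      refine ⟨C + C', fun ω => ?_⟩
      rw [hS_succ]
      exact (abs_add_le _ _).trans (add_le_add (hC ω) (hC' ω))
  have hint : ∀ {f : Ω → ℝ}, AEStronglyMeasurable f μ → (∃ C, ∀ ω, |f ω| ≤ C) → Integrable f μ :=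
    fun hf ⟨C, hC⟩ => Integrable.of_bound hf C (Eventually.of_forall hC)
  have hmulb : ∀ {f g : Ω → ℝ}, (∃ C, ∀ ω, |f ω| ≤ C) → (∃ C, ∀ ω, |g ω| ≤ C) →
      ∃ C, ∀ ω, |(f * g) ω| ≤ C := by
    rintro f g ⟨C, hC⟩ ⟨C', hC'⟩
    refine ⟨C * C', fun ω => ?_⟩
    rw [Pi.mul_apply, abs_mul]
    exact mul_le_mul (hC ω) (hC' ω) (abs_nonneg _) ((abs_nonneg _).trans (hC ω))
  have hSam : ∀ n, AEStronglyMeasurable (S n) μ :=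
    fun n => ((hSm n).mono (𝒢.le n)).aestronglyMeasurable
  have hDam : ∀ n, AEStronglyMeasurable (D n) μ :=
    fun n => ((hmeas n).mono (𝒢.le _)).aestronglyMeasurable
  have hSi : ∀ n, Integrable (S n) μ := fun n => hint (hSam n) (hSb n)
  have hmart : Martingale S 𝒢 μ := by
    refine martingale_of_condExp_sub_eq_zero_nat hSm hSi fun i => ?_
    rw [hS_succ, add_sub_cancel_left]
    exact hzero i
  have hcross : ∀ n, ∫ ω, S n ω * D n ω ∂μ = 0 := by
    intro n
    have h1 := condExp_mul_of_stronglyMeasurable_left (μ := μ) (hSm n)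
      (hint ((hSam n).mul (hDam n)) (hmulb (hSb n) (hbdd n))) (hint (hDam n) (hbdd n))
    have h2 : μ[S n * D n | 𝒢 n] =ᵐ[μ] 0 := by
      filter_upwards [h1, hzero n] with ω h h'
      simp [h, h']
    have h3 := integral_condExp (μ := μ) (f := S n * D n) (𝒢.le n)
    rw [integral_congr_ae h2] at h3
    simpa using h3.symm
  have hsq : ∀ n, ∫ ω, S n ω ^ 2 ∂μ = ∑ i ∈ range n, ∫ ω, D i ω ^ 2 ∂μ := by
    intro n
    induction n with
    | zero => simp [hS]
    | succ n ih =>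
      have i1 : Integrable (fun ω => S n ω ^ 2) μ := by
        simp only [sq]; exact hint ((hSam n).mul (hSam n)) (hmulb (hSb n) (hSb n))
      have i2 : Integrable (fun ω => D n ω ^ 2) μ := by
        simp only [sq]; exact hint ((hDam n).mul (hDam n)) (hmulb (hbdd n) (hbdd n))
      have i3 : Integrable (fun ω => S n ω * D n ω) μ :=
        hint ((hSam n).mul (hDam n)) (hmulb (hSb n) (hbdd n))
      have e : (fun ω => S (n + 1) ω ^ 2) =
          fun ω => S n ω ^ 2 + D n ω ^ 2 + 2 * (S n ω * D n ω) := by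
        ext ω; rw [hS_succ, Pi.add_apply]; ring
      rw [e, integral_add (f := fun ω => S n ω ^ 2 + D n ω ^ 2) (i1.add i2) (i3.const_mul 2),
        integral_add i1 i2, integral_const_mul,
        hcross, ih, sum_range_succ]
      ring
  have hL1 : ∀ n, eLpNorm (S n) 1 μ ≤ (1 + ∑' i, ∫ ω, D i ω ^ 2 ∂μ).toNNReal := by
    intro n
    have i1 : Integrable (fun ω => S n ω ^ 2) μ := by
      simp only [sq]; exact hint ((hSam n).mul (hSam n)) (hmulb (hSb n) (hSb n))
    rw [eLpNorm_one_eq_lintegral_enorm, ← ofReal_integral_norm_eq_lintegral_enorm (hSi n)]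
    refine ENNReal.ofReal_le_ofReal ?_
    calc ∫ ω, ‖S n ω‖ ∂μ ≤ ∫ ω, (1 + S n ω ^ 2) ∂μ := by
          refine integral_mono (hSi n).norm ((integrable_const 1).add i1) fun ω => ?_
          simp only [Real.norm_eq_abs]
          nlinarith [sq_abs (S n ω), sq_nonneg (|S n ω| - 1)]
      _ = 1 + ∑ i ∈ range n, ∫ ω, D i ω ^ 2 ∂μ := by
          rw [integral_add (integrable_const 1) i1, hsq]; simp
      _ ≤ _ := by
          gcongr
          exact hsum.sum_le_tsum _ fun i _ => integral_nonneg fun ω => sq_nonneg _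
  filter_upwards [hmart.submartingale.ae_tendsto_limitProcess hL1] with ω hω
  exact ⟨_, hω⟩

/-- **Kronecker's lemma.** -/
theorem isLittleO_sum_of_tendsto_sum_div {a b : ℕ → ℝ} {l : ℝ} (hb : Monotone b)
    (hpos : ∀ n, 0 < b n) (hb' : Tendsto b atTop atTop)
    (h : Tendsto (fun n => ∑ i ∈ range n, a i / b i) atTop (nhds l)) :
    (fun n => ∑ i ∈ range n, a i) =o[atTop] b := by
  set T : ℕ → ℝ := fun n => ∑ i ∈ range n, a i / b i with hT
  have hparts : ∀ n, ∑ i ∈ range n, a i =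
      b n * (T n - l) + b 0 * l - ∑ i ∈ range n, (b (i + 1) - b i) * (T (i + 1) - l) := by
    intro n
    induction n with
    | zero => simp [hT]
    | succ n ih =>
      have : a n = b n * (T (n + 1) - T n) := by
        simp only [hT, sum_range_succ, add_sub_cancel_left]
        field_simp [(hpos n).ne']
      rw [sum_range_succ, ih, sum_range_succ, this]
      ring
  have hT0 : Tendsto (fun n => T n - l) atTop (nhds 0) := by simpa using h.sub_const l
  have h1 : (fun n => b n * (T n - l)) =o[atTop] b := by
    simpa using (isBigO_refl b atTop).mul_isLittleO ((isLittleO_one_iff ℝ).2 hT0)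
  have h2 : (fun _ : ℕ => b 0 * l) =o[atTop] b :=
    isLittleO_const_left.2 (Or.inr (tendsto_abs_atTop_atTop.comp hb'))
  have hsum : ∀ n, ∑ i ∈ range n, (b (i + 1) - b i) = b n - b 0 := fun n => sum_range_sub b n
  have h3 : (fun n => ∑ i ∈ range n, (b (i + 1) - b i) * (T (i + 1) - l)) =o[atTop] b := by
    have h4 : (fun i => (b (i + 1) - b i) * (T (i + 1) - l)) =o[atTop]
        fun i => b (i + 1) - b i := by
      simpa using (isBigO_refl (fun i => b (i + 1) - b i) atTop).mul_isLittleO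
        ((isLittleO_one_iff ℝ).2 ((tendsto_add_atTop_iff_nat 1).2 hT0))
    have h5 := h4.sum_range (fun i => sub_nonneg.2 (hb i.le_succ)) (by
      simp only [hsum]
      exact tendsto_atTop_add_const_right _ (-b 0) hb')
    refine h5.trans_isBigO (IsBigO.of_bound 1 (Eventually.of_forall fun n => ?_))
    rw [hsum, one_mul, Real.norm_of_nonneg (sub_nonneg.2 (hb n.zero_le)),
      Real.norm_of_nonneg (hpos n).le]
    linarith [hpos 0]
  simp only [hparts]
  exact (h1.add h2).sub h3

/-- The real-valued indicator of `m ∈ A`. -/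
noncomputable def memInd (A : Set ℕ) (m : ℕ) : ℝ := if m ∈ A then 1 else 0

theorem memInd_nonneg (A : Set ℕ) (m : ℕ) : 0 ≤ memInd A m := by
  unfold memInd; split_ifs <;> norm_num

theorem memInd_le_one (A : Set ℕ) (m : ℕ) : memInd A m ≤ 1 := by
  unfold memInd; split_ifs <;> norm_num

theorem memInd_sq (A : Set ℕ) (m : ℕ) : memInd A m ^ 2 = memInd A m := by
  unfold memInd; split_ifs <;> norm_num

theorem hawkinsY_succ (A : Set ℕ) (m : ℕ) :
    hawkinsY A (m + 1) = hawkinsY A m * (1 - memInd A m / m) := by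
  rw [hawkinsY, prod_range_succ, ← hawkinsY, memInd]
  split_ifs <;> simp

theorem memInd_div_le {A : Set ℕ} (hA : ∀ n ∈ A, 2 ≤ n) (m : ℕ) : memInd A m / m ≤ 1 / 2 := by
  unfold memInd
  split_ifs with h
  · have : (2 : ℝ) ≤ m := by exact_mod_cast hA m h
    exact one_div_le_one_div_of_le two_pos this
  · norm_num

theorem hawkinsY_pos {A : Set ℕ} (hA : ∀ n ∈ A, 2 ≤ n) (m : ℕ) : 0 < hawkinsY A m := by
  induction m with
  | zero => simp [hawkinsY]
  | succ m ih =>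
    rw [hawkinsY_succ]
    exact mul_pos ih (by linarith [memInd_div_le hA m])

theorem hawkinsY_succ_le {A : Set ℕ} (hA : ∀ n ∈ A, 2 ≤ n) (m : ℕ) :
    hawkinsY A (m + 1) ≤ hawkinsY A m := by
  rw [hawkinsY_succ]
  exact mul_le_of_le_one_right (hawkinsY_pos hA m).le
    (by linarith [div_nonneg (memInd_nonneg A m) m.cast_nonneg])

theorem hawkinsY_antitone {A : Set ℕ} (hA : ∀ n ∈ A, 2 ≤ n) : Antitone (hawkinsY A) :=
  antitone_nat_of_succ_le (hawkinsY_succ_le hA)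

theorem hawkinsY_le_one {A : Set ℕ} (hA : ∀ n ∈ A, 2 ≤ n) (m : ℕ) : hawkinsY A m ≤ 1 := by
  simpa [hawkinsY] using hawkinsY_antitone hA m.zero_le

theorem pow_le_hawkinsY {A : Set ℕ} (hA : ∀ n ∈ A, 2 ≤ n) (m : ℕ) : (1 / 2 :
    ℝ) ^ m ≤ hawkinsY A m := by
  induction m with
  | zero => simp [hawkinsY]
  | succ m ih =>
    rw [hawkinsY_succ, pow_succ]
    exact mul_le_mul ih (by linarith [memInd_div_le hA m]) (by norm_num) (hawkinsY_pos hA m).le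

theorem abs_memInd_sub_hawkinsY_le {A : Set ℕ} (hA : ∀ n ∈ A, 2 ≤ n) (m : ℕ) :
    |memInd A m - hawkinsY A m| ≤ 1 := by
  rw [abs_le]
  constructor <;>
    linarith [memInd_nonneg A m, memInd_le_one A m, hawkinsY_pos hA m, hawkinsY_le_one hA m]

theorem hawkinsY_sub_le {A : Set ℕ} (hA : ∀ n ∈ A, 2 ≤ n) {m : ℕ} (hm : 0 < m) (k : ℕ) :
    hawkinsY A m - hawkinsY A (m + k) ≤ k / m := by
  induction k with
  | zero => simp
  | succ k ih =>
    have h1 : hawkinsY A (m + k) * (memInd A (m + k) / (m + k : ℕ)) ≤ 1 * (1 / m) := by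
      refine mul_le_mul (hawkinsY_le_one hA _) ?_
        (div_nonneg (memInd_nonneg _ _) (Nat.cast_nonneg _)) zero_le_one
      have : (m : ℝ) ≤ (m + k : ℕ) := by exact_mod_cast Nat.le_add_right m k
      have hm' : (0 : ℝ) < m := by exact_mod_cast hm
      exact div_le_div₀ zero_le_one (memInd_le_one _ _) hm' this
    rw [← add_assoc, hawkinsY_succ]
    push_cast at h1 ⊢
    rw [add_div]
    linarith

theorem inv_hawkinsY_succ {A : Set ℕ} (hA : ∀ n ∈ A, 2 ≤ n) (i : ℕ) : (hawkinsY A (2 + (i + 1)))⁻¹ =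
    (hawkinsY A (2 + i))⁻¹ + memInd A (2 + i) * ((hawkinsY A (2 + i))⁻¹ / (i + 1)) := by
  rw [← add_assoc, hawkinsY_succ]
  have h0 := (hawkinsY_pos hA (2 + i)).ne'
  have h1 : (i : ℝ) + 1 ≠ 0 := by positivity
  have h2 : (2 : ℝ) + i ≠ 0 := by positivity
  unfold memInd
  split_ifs
  · have : 1 - 1 / (2 + i : ℝ) = (i + 1) / (2 + i) := by field_simp; ring
    push_cast
    rw [this]
    field_simp
    ring
  · simp

theorem hawkinsY_two {A : Set ℕ} (hA : ∀ n ∈ A, 2 ≤ n) : hawkinsY A 2 = 1 := by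
  have h0 : 0 ∉ A := fun h => by simpa using hA 0 h
  have h1 : 1 ∉ A := fun h => by simpa using hA 1 h
  simp [hawkinsY, prod_range_succ, h0, h1]

theorem sieveSigma_mono {Ω : Type*} (α : Ω → Set ℕ) :
    Monotone (sieveSigma α) := by
  refine fun m n hmn => MeasurableSpace.generateFrom_mono ?_
  rintro s ⟨j, h2, hj, rfl⟩
  exact ⟨j, h2, hj.trans_le hmn, rfl⟩

section

variable {Ω : Type*} [m0 : MeasurableSpace Ω] {μ : Measure Ω} {α : Ω → Set ℕ}

namespace IsHawkinsSieve

theorem sieveSigma_le (h : IsHawkinsSieve μ α) (m : ℕ) : sieveSigma α m ≤ m0 := by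
  refine MeasurableSpace.generateFrom_le ?_
  rintro s ⟨j, -, -, rfl⟩
  exact h.meas j

theorem stronglyMeasurable_memInd (h : IsHawkinsSieve μ α) {j m : ℕ} (hj : j < m) :
    StronglyMeasurable[sieveSigma α m] fun ω => memInd (α ω) j := by
  have hs : MeasurableSet[sieveSigma α m] {ω | j ∈ α ω} := by
    by_cases h2 : 2 ≤ j
    · exact MeasurableSpace.measurableSet_generateFrom ⟨j, h2, hj, rfl⟩
    · have : {ω | j ∈ α ω} = ∅ :=
        Set.eq_empty_of_forall_notMem fun ω hω => h2 (h.mem_ge_two ω j hω)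
      rw [this]
      exact @MeasurableSet.empty _ (sieveSigma α m)
  exact StronglyMeasurable.ite hs stronglyMeasurable_const stronglyMeasurable_const

theorem stronglyMeasurable_hawkinsY (h : IsHawkinsSieve μ α) (m : ℕ) :
    StronglyMeasurable[sieveSigma α m] fun ω => hawkinsY (α ω) m := by
  have key : ∀ n ≤ m, StronglyMeasurable[sieveSigma α m] fun ω => hawkinsY (α ω) n := by
    intro n
    induction n with
    | zero => exact fun _ => by simpa [hawkinsY] using stronglyMeasurable_const
    | succ n ih =>
      intro hn
      simp only [hawkinsY_succ, div_eq_mul_inv]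
      exact (ih (by omega)).mul
        (stronglyMeasurable_const.sub ((h.stronglyMeasurable_memInd hn).mul_const _))
  exact key m le_rfl

theorem stronglyMeasurable_inv_hawkinsY (h : IsHawkinsSieve μ α) (m : ℕ) :
    StronglyMeasurable[sieveSigma α m] fun ω => (hawkinsY (α ω) m)⁻¹ :=
  (h.stronglyMeasurable_hawkinsY m).measurable.inv.stronglyMeasurable

theorem stronglyMeasurable_memInd_sub (h : IsHawkinsSieve μ α) (m : ℕ) :
    StronglyMeasurable[sieveSigma α (m + 1)] fun ω => memInd (α ω) m - hawkinsY (α ω) m :=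
  (h.stronglyMeasurable_memInd m.lt_succ_self).sub
    ((h.stronglyMeasurable_hawkinsY m).mono (sieveSigma_mono α m.le_succ))

theorem integrable_of_abs_le (h : IsHawkinsSieve μ α) {f : Ω → ℝ} {m : ℕ}
    (hf : StronglyMeasurable[sieveSigma α m] f)
    {C : ℝ} (hC : ∀ ω, |f ω| ≤ C) : Integrable f μ :=
  have := h.isProb
  Integrable.of_bound (hf.mono (h.sieveSigma_le m)).aestronglyMeasurable C
    (Eventually.of_forall hC)

theorem condExp_memInd_sub_mul (h : IsHawkinsSieve μ α) {m : ℕ} (hm : 2 ≤ m) {g : Ω → ℝ}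
    (hg : StronglyMeasurable[sieveSigma α m] g) {C : ℝ} (hC : ∀ ω, |g ω| ≤ C) :
    μ[fun ω => (memInd (α ω) m - hawkinsY (α ω) m) * g ω | sieveSigma α m] =ᵐ[μ] 0 := by
  have := h.isProb
  have hXi : Integrable (fun ω => memInd (α ω) m) μ :=
    h.integrable_of_abs_le (h.stronglyMeasurable_memInd m.lt_succ_self) (C := 1) fun ω => by
      rw [abs_of_nonneg (memInd_nonneg _ _)]; exact memInd_le_one _ _
  have hYi : Integrable (fun ω => hawkinsY (α ω) m) μ :=
    h.integrable_of_abs_le (h.stronglyMeasurable_hawkinsY m) (C := 1) fun ω => by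
      rw [abs_of_pos (hawkinsY_pos (h.mem_ge_two ω) m)]
      exact hawkinsY_le_one (h.mem_ge_two ω) m
  have hX : μ[fun ω => memInd (α ω) m | sieveSigma α m] =ᵐ[μ] fun ω => hawkinsY (α ω) m := by
    convert h.condExp_mem m hm using 2
    ext ω
    simp [memInd, Set.indicator_apply]
  have hY : μ[fun ω => hawkinsY (α ω) m | sieveSigma α m] = fun ω => hawkinsY (α ω) m :=
    condExp_of_stronglyMeasurable (h.sieveSigma_le m) (h.stronglyMeasurable_hawkinsY m) hYi
  have hprod : Integrable
      ((fun ω => memInd (α ω) m - hawkinsY (α ω) m) * g) μ :=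
    h.integrable_of_abs_le ((h.stronglyMeasurable_memInd_sub m).mul
      (hg.mono (sieveSigma_mono α m.le_succ))) (C := C) fun ω => by
        rw [Pi.mul_apply, abs_mul]
        exact (mul_le_of_le_one_left (abs_nonneg _)
          (abs_memInd_sub_hawkinsY_le (h.mem_ge_two ω) m)).trans (hC ω)
  have h1 := condExp_mul_of_stronglyMeasurable_right hg hprod (hXi.sub hYi)
  have h2 := condExp_sub hXi hYi (sieveSigma α m)
  rw [hY] at h2
  filter_upwards [h1, h2, hX] with ω e1 e2 e3
  refine e1.trans ?_
  have e4 : (μ[fun ω => memInd (α ω) m - hawkinsY (α ω) m | sieveSigma α m]) ω = 0 := by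
    refine e2.trans ?_
    rw [Pi.sub_apply, e3, sub_self]
  rw [Pi.mul_apply, e4, zero_mul, Pi.zero_apply]

theorem integral_memInd_sub_mul (h : IsHawkinsSieve μ α) {m : ℕ} (hm : 2 ≤ m) {g : Ω → ℝ}
    (hg : StronglyMeasurable[sieveSigma α m] g) {C : ℝ} (hC : ∀ ω, |g ω| ≤ C) :
    ∫ ω, (memInd (α ω) m - hawkinsY (α ω) m) * g ω ∂μ = 0 := by
  have := h.isProb
  rw [← integral_condExp (h.sieveSigma_le m), integral_congr_ae (h.condExp_memInd_sub_mul hm hg hC)]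
  simp

theorem ae_exists_tendsto_sum (h : IsHawkinsSieve μ α) {s : ℕ} (hs : 2 ≤ s) {g : ℕ → Ω → ℝ}
    (hg : ∀ i, StronglyMeasurable[sieveSigma α (s + i)] (g i))
    (hC : ∀ i, ∃ C, ∀ ω, |g i ω| ≤ C)
    (hsum : Summable fun i =>
      ∫ ω, ((memInd (α ω) (s + i) - hawkinsY (α ω) (s + i)) * g i ω) ^ 2 ∂μ) :
    ∀ᵐ ω ∂μ, ∃ l : ℝ, Tendsto (fun n => ∑ i ∈ range n,
      (memInd (α ω) (s + i) - hawkinsY (α ω) (s + i)) * g i ω) atTop (nhds l) := by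
  have := h.isProb
  refine ae_exists_tendsto_sum_of_condExp_eq_zero
    (D := fun i ω => (memInd (α ω) (s + i) - hawkinsY (α ω) (s + i)) * g i ω)
    ⟨fun i => sieveSigma α (s + i), fun i j hij => sieveSigma_mono α (by omega),
      fun i => h.sieveSigma_le _⟩ (fun i => ?_) (fun i => ?_) (fun i => ?_) hsum
  · exact (h.stronglyMeasurable_memInd_sub (s + i)).mul
      ((hg i).mono (sieveSigma_mono α (Nat.le_succ _)))
  · obtain ⟨C, hC⟩ := hC i
    refine ⟨C, fun ω => ?_⟩
    rw [abs_mul]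
    exact (mul_le_of_le_one_left (abs_nonneg _)
      (abs_memInd_sub_hawkinsY_le (h.mem_ge_two ω) _)).trans (hC ω)
  · obtain ⟨C, hC⟩ := hC i
    exact h.condExp_memInd_sub_mul (by omega) (hg i) hC

theorem ae_isLittleO_sum (h : IsHawkinsSieve μ α) {s : ℕ} (hs : 2 ≤ s) {g : ℕ → Ω → ℝ}
    (hg : ∀ i, StronglyMeasurable[sieveSigma α (s + i)] (g i))
    (hC : ∀ i ω, |g i ω| ≤ 1) :
    ∀ᵐ ω ∂μ, (fun n => ∑ i ∈ range n,
      (memInd (α ω) (s + i) - hawkinsY (α ω) (s + i)) * g i ω) =o[atTop]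
        fun n : ℕ => ((n : ℝ) + 1) ^ (3 / 4 : ℝ) := by
  have := h.isProb
  have hb1 : ∀ i : ℕ, (1 : ℝ) ≤ ((i : ℝ) + 1) ^ (3 / 4 : ℝ) := fun i =>
    Real.one_le_rpow (by linarith [i.cast_nonneg (α := ℝ)]) (by norm_num)
  have key := h.ae_exists_tendsto_sum hs
    (g := fun i ω => g i ω * (((i : ℝ) + 1) ^ (3 / 4 : ℝ))⁻¹)
    (fun i => (hg i).mul_const _)
    (fun i => ⟨1, fun ω => by
      rw [abs_mul, abs_of_pos (inv_pos.2 (zero_lt_one.trans_le (hb1 i)))]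
      exact mul_le_one₀ (hC i ω) (by positivity) (inv_le_one_of_one_le₀ (hb1 i))⟩)
    (by
      have hs : Summable fun i : ℕ => ((i : ℝ) + 1) ^ (-(3 / 2) : ℝ) := by
        have := (Real.summable_nat_rpow (p := -(3 / 2))).2 (by norm_num)
        simpa using (summable_nat_add_iff 1).2 this
      refine Summable.of_nonneg_of_le (fun i => integral_nonneg fun ω => sq_nonneg _)
        (fun i => ?_) hs
      have hle : ∀ ω, ((memInd (α ω) (s + i) - hawkinsY (α ω) (s + i)) *
          (g i ω * (((i : ℝ) + 1) ^ (3 / 4 : ℝ))⁻¹)) ^ 2 ≤ ((i : ℝ) + 1) ^ (-(3 / 2) : ℝ) := by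
        intro ω
        have e : (((i : ℝ) + 1) ^ (3 / 4 : ℝ))⁻¹ ^ 2 = ((i : ℝ) + 1) ^ (-(3 / 2) : ℝ) := by
          have h0 : (0 : ℝ) ≤ i + 1 := by positivity
          rw [← Real.rpow_neg h0, ← Real.rpow_mul_natCast h0]
          norm_num
        rw [← mul_assoc, mul_pow, e]
        refine mul_le_of_le_one_left (by positivity) ?_
        rw [sq_le_one_iff_abs_le_one, abs_mul]
        exact mul_le_one₀ (abs_memInd_sub_hawkinsY_le (h.mem_ge_two ω) _) (abs_nonneg _) (hC i ω)
      calc _ ≤ ∫ ω, ((i : ℝ) + 1) ^ (-(3 / 2) : ℝ) ∂μ :=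
            integral_mono_of_nonneg (Eventually.of_forall fun ω => sq_nonneg _)
              (integrable_const _) (Eventually.of_forall hle)
        _ = _ := by simp)
  filter_upwards [key] with ω ⟨l, hl⟩
  refine isLittleO_sum_of_tendsto_sum_div (l := l) (fun i j hij => ?_)
    (fun n => zero_lt_one.trans_le (hb1 n)) ?_ ?_
  · have : (i : ℝ) ≤ j := by exact_mod_cast hij
    exact Real.rpow_le_rpow (by positivity) (by linarith) (by norm_num)
  · exact (tendsto_rpow_atTop (by norm_num)).comp
      (tendsto_atTop_add_const_right _ _ tendsto_natCast_atTop_atTop)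
  · simpa only [div_eq_mul_inv, mul_assoc] using hl

theorem inv_hawkinsY_le (h : IsHawkinsSieve μ α) (m : ℕ) (ω : Ω) :
    (hawkinsY (α ω) m)⁻¹ ≤ 2 ^ m := by
  have := inv_anti₀ (by positivity) (pow_le_hawkinsY (h.mem_ge_two ω) m)
  simpa using this

theorem abs_inv_hawkinsY_le (h : IsHawkinsSieve μ α) (m : ℕ) (ω : Ω) :
    |(hawkinsY (α ω) m)⁻¹| ≤ 2 ^ m := by
  rw [abs_of_pos (inv_pos.2 (hawkinsY_pos (h.mem_ge_two ω) m))]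
  exact h.inv_hawkinsY_le m ω

theorem abs_inv_hawkinsY_div_le (h : IsHawkinsSieve μ α) (i : ℕ) (ω : Ω) :
    |(hawkinsY (α ω) (2 + i))⁻¹ / ((i : ℝ) + 1)| ≤ 2 ^ (2 + i) := by
  have h1 : (1 : ℝ) ≤ i + 1 := by linarith [i.cast_nonneg (α := ℝ)]
  rw [abs_div, abs_of_pos (zero_lt_one.trans_le h1)]
  exact (div_le_self (abs_nonneg _) h1).trans (h.abs_inv_hawkinsY_le _ ω)

theorem stronglyMeasurable_inv_hawkinsY_div (h : IsHawkinsSieve μ α) (i : ℕ) :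
    StronglyMeasurable[sieveSigma α (2 + i)]
      fun ω => (hawkinsY (α ω) (2 + i))⁻¹ / ((i : ℝ) + 1) := by
  simp only [div_eq_mul_inv]
  exact (h.stronglyMeasurable_inv_hawkinsY _).mul_const _

theorem inv_hawkinsY_succ_eq (h : IsHawkinsSieve μ α) (i : ℕ) (ω : Ω) :
    (hawkinsY (α ω) (2 + (i + 1)))⁻¹ =
    (hawkinsY (α ω) (2 + i))⁻¹ + 1 / ((i : ℝ) + 1) +
      (memInd (α ω) (2 + i) - hawkinsY (α ω) (2 + i)) *
        ((hawkinsY (α ω) (2 + i))⁻¹ / (i + 1)) := by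
  have h0 := (hawkinsY_pos (h.mem_ge_two ω) (2 + i)).ne'
  rw [inv_hawkinsY_succ (h.mem_ge_two ω)]
  field_simp
  ring

theorem integral_inv_hawkinsY_le (h : IsHawkinsSieve μ α) (i : ℕ) :
    ∫ ω, (hawkinsY (α ω) (2 + i))⁻¹ ∂μ ≤ 3 * √((i : ℝ) + 1) := by
  have := h.isProb
  induction i with
  | zero =>
    simp only [add_zero, fun ω => hawkinsY_two (h.mem_ge_two ω)]
    norm_num
  | succ i ih =>
    have i1 : Integrable (fun ω => (hawkinsY (α ω) (2 + i))⁻¹) μ :=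
      h.integrable_of_abs_le (h.stronglyMeasurable_inv_hawkinsY _) (h.abs_inv_hawkinsY_le _)
    have i2 : Integrable (fun ω => (memInd (α ω) (2 + i) - hawkinsY (α ω) (2 + i)) *
        ((hawkinsY (α ω) (2 + i))⁻¹ / ((i : ℝ) + 1))) μ :=
      h.integrable_of_abs_le ((h.stronglyMeasurable_memInd_sub (2 + i)).mul
        ((h.stronglyMeasurable_inv_hawkinsY_div i).mono (sieveSigma_mono α (Nat.le_succ _))))
        (C := 2 ^ (2 + i)) fun ω => by
          rw [abs_mul]
          exact (mul_le_of_le_one_left (abs_nonneg _)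
            (abs_memInd_sub_hawkinsY_le (h.mem_ge_two ω) _)).trans (h.abs_inv_hawkinsY_div_le i ω)
    simp only [h.inv_hawkinsY_succ_eq]
    rw [integral_add (f := fun ω => (hawkinsY (α ω) (2 + i))⁻¹ + 1 / ((i : ℝ) + 1))
      (i1.add (integrable_const _)) i2, integral_add i1 (integrable_const _),
      h.integral_memInd_sub_mul (by omega) (h.stronglyMeasurable_inv_hawkinsY_div i)
        (h.abs_inv_hawkinsY_div_le i)]
    simp only [integral_const, probReal_univ, one_smul, add_zero]
    push_cast
    set s := √((i : ℝ) + 1)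
    set t := √((i : ℝ) + 1 + 1)
    have hs : s ^ 2 = i + 1 := Real.sq_sqrt (by positivity)
    have ht : t ^ 2 = i + 1 + 1 := Real.sq_sqrt (by positivity)
    have hi : (0 : ℝ) ≤ i := i.cast_nonneg
    have hs1 : 1 ≤ s := Real.one_le_sqrt.2 (by linarith)
    have ht2 : t ≤ 2 * s := abs_le_of_sq_le_sq' (by nlinarith) (by linarith) |>.2
    have ht0 : 0 ≤ t := Real.sqrt_nonneg _
    have hst : 1 / ((i : ℝ) + 1) ≤ 3 * (t - s) := by
      rw [← hs, div_le_iff₀ (by positivity)]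
      have h1 : (t - s) * (t + s) = 1 := by nlinarith
      have h2 : 0 < t - s := by
        by_contra! hc
        nlinarith
      nlinarith [mul_le_mul_of_nonneg_left (show t + s ≤ 3 * s ^ 2 by nlinarith) h2.le]
    linarith

theorem summable_integral_sq (h : IsHawkinsSieve μ α) :
    Summable fun i : ℕ => ∫ ω, ((memInd (α ω) (2 + i) - hawkinsY (α ω) (2 + i)) *
      ((hawkinsY (α ω) (2 + i))⁻¹ / ((i : ℝ) + 1))) ^ 2 ∂μ := by
  have := h.isProb
  have hs : Summable fun i : ℕ => 3 * ((i : ℝ) + 1) ^ (-(3 / 2) : ℝ) := by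
    have := (Real.summable_nat_rpow (p := -(3 / 2))).2 (by norm_num)
    simpa using ((summable_nat_add_iff 1).2 this).mul_left 3
  refine Summable.of_nonneg_of_le (fun i => integral_nonneg fun ω => sq_nonneg _) (fun i => ?_) hs
  set G : Ω → ℝ := fun ω => (hawkinsY (α ω) (2 + i))⁻¹ / ((i : ℝ) + 1) with hG
  set g : Ω → ℝ := fun ω => (1 - 2 * hawkinsY (α ω) (2 + i)) * G ω ^ 2 with hg
  have hGm := h.stronglyMeasurable_inv_hawkinsY_div i
  have hYm := h.stronglyMeasurable_hawkinsY (2 + i)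
  have hgm : StronglyMeasurable[sieveSigma α (2 + i)] g :=
    (stronglyMeasurable_const.sub (hYm.const_mul 2)).mul (hGm.pow 2)
  have hgC : ∀ ω, |g ω| ≤ (2 ^ (2 + i)) ^ 2 := fun ω => by
    have h0 := hawkinsY_pos (h.mem_ge_two ω) (2 + i)
    have h1 := hawkinsY_le_one (h.mem_ge_two ω) (2 + i)
    rw [hg, abs_mul, abs_pow]
    refine (mul_le_of_le_one_left (by positivity) ?_).trans
      (pow_le_pow_left₀ (abs_nonneg _) (h.abs_inv_hawkinsY_div_le i ω) 2)
    rw [abs_le]; constructor <;> linarith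
  have i1 : Integrable (fun ω => (memInd (α ω) (2 + i) - hawkinsY (α ω) (2 + i)) * g ω) μ :=
    h.integrable_of_abs_le ((h.stronglyMeasurable_memInd_sub (2 + i)).mul
      (hgm.mono (sieveSigma_mono α (Nat.le_succ _)))) (C := (2 ^ (2 + i)) ^ 2) fun ω => by
        rw [abs_mul]
        exact (mul_le_of_le_one_left (abs_nonneg _)
          (abs_memInd_sub_hawkinsY_le (h.mem_ge_two ω) _)).trans (hgC ω)
  have i2 : Integrable (fun ω => (hawkinsY (α ω) (2 + i))⁻¹ * (((i : ℝ) + 1) ^ 2)⁻¹) μ :=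
    (h.integrable_of_abs_le (h.stronglyMeasurable_inv_hawkinsY _)
      (h.abs_inv_hawkinsY_le _)).mul_const _
  calc _ ≤ ∫ ω, ((memInd (α ω) (2 + i) - hawkinsY (α ω) (2 + i)) * g ω +
        (hawkinsY (α ω) (2 + i))⁻¹ * (((i : ℝ) + 1) ^ 2)⁻¹) ∂μ := by
        refine integral_mono_of_nonneg (Eventually.of_forall fun ω => sq_nonneg _) (i1.add i2)
          (Eventually.of_forall fun ω => ?_)
        have h0 := hawkinsY_pos (h.mem_ge_two ω) (2 + i)
        have hX := memInd_sq (α ω) (2 + i)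
        simp only [hg, hG]
        set X := memInd (α ω) (2 + i)
        set Y := hawkinsY (α ω) (2 + i)
        have e : ((X - Y) * (Y⁻¹ / ((i : ℝ) + 1))) ^ 2 =
            (X - Y) * ((1 - 2 * Y) * (Y⁻¹ / ((i : ℝ) + 1)) ^ 2) +
              Y⁻¹ * (((i : ℝ) + 1) ^ 2)⁻¹ - (((i : ℝ) + 1) ^ 2)⁻¹ := by
          field_simp
          linear_combination hX
        rw [e]
        have : 0 ≤ (((i : ℝ) + 1) ^ 2)⁻¹ := by positivity
        linarith
    _ = (∫ ω, (hawkinsY (α ω) (2 + i))⁻¹ ∂μ) * (((i : ℝ) + 1) ^ 2)⁻¹ := by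
        rw [integral_add i1 i2, h.integral_memInd_sub_mul (by omega) hgm hgC, zero_add,
          integral_mul_const]
    _ ≤ 3 * √((i : ℝ) + 1) * (((i : ℝ) + 1) ^ 2)⁻¹ := by
        gcongr
        exact h.integral_inv_hawkinsY_le i
    _ = _ := by
        have h0 : (0 : ℝ) < i + 1 := by positivity
        rw [mul_assoc, Real.sqrt_eq_rpow, ← Real.rpow_natCast, ← Real.rpow_neg h0.le,
          ← Real.rpow_add h0]
        norm_num

/-- The analogue of Mertens' theorem: almost surely `y_m ~ 1 / log m`. -/
theorem ae_tendsto_hawkinsY_mul_log (h : IsHawkinsSieve μ α) :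
    ∀ᵐ ω ∂μ, Tendsto (fun m : ℕ => hawkinsY (α ω) m * Real.log m) atTop (nhds 1) := by
  filter_upwards [h.ae_exists_tendsto_sum le_rfl h.stronglyMeasurable_inv_hawkinsY_div
    (fun i => ⟨_, h.abs_inv_hawkinsY_div_le i⟩) h.summable_integral_sq] with ω ⟨l, hl⟩
  have hsum : ∀ n : ℕ, (hawkinsY (α ω) (2 + n))⁻¹ = 1 + harmonic n + ∑ i ∈ range n,
      (memInd (α ω) (2 + i) - hawkinsY (α ω) (2 + i)) *
        ((hawkinsY (α ω) (2 + i))⁻¹ / ((i : ℝ) + 1)) := by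
    intro n
    induction n with
    | zero => simp [hawkinsY_two (h.mem_ge_two ω)]
    | succ n ih =>
      rw [h.inv_hawkinsY_succ_eq, sum_range_succ, harmonic_succ]
      push_cast
      linear_combination ih
  have hlog : Tendsto (fun n : ℕ => Real.log n) atTop atTop :=
    Real.tendsto_log_atTop.comp tendsto_natCast_atTop_atTop
  have hdiff : Tendsto (fun n : ℕ => (hawkinsY (α ω) (2 + n))⁻¹ - Real.log (2 + n : ℕ)) atTop
      (nhds (1 + Real.eulerMascheroniConstant - 0 + l)) := by
    have hl2 : Tendsto (fun n : ℕ => Real.log (2 + n : ℕ) - Real.log n) atTop (nhds 0) := by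
      have := (Real.tendsto_log_comp_add_sub_log 2).comp (tendsto_natCast_atTop_atTop (R := ℝ))
      refine this.congr fun n => ?_
      simp [add_comm]
    refine (((Real.tendsto_harmonic_sub_log.const_add 1).sub hl2).add hl).congr fun n => ?_
    rw [hsum]
    ring
  have hlog2 : Tendsto (fun n : ℕ => Real.log (2 + n : ℕ)) atTop atTop := by
    simpa only [add_comm] using (tendsto_add_atTop_iff_nat 2).2 hlog
  have hratio : Tendsto (fun n : ℕ => (hawkinsY (α ω) (2 + n))⁻¹ / Real.log (2 + n : ℕ)) atTop
      (nhds 1) := by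
    have h1 := (hdiff.div_atTop hlog2).add_const 1
    rw [zero_add] at h1
    refine h1.congr' ?_
    filter_upwards [hlog2.eventually_gt_atTop 0] with n hn
    field_simp
    ring
  have h2 := hratio.inv₀ one_ne_zero
  rw [inv_one] at h2
  refine (tendsto_add_atTop_iff_nat 2).1 (h2.congr fun n => ?_)
  rw [inv_div, add_comm 2 n, div_inv_eq_mul, mul_comm]

end IsHawkinsSieve

end

theorem tendsto_log_div_log_succ :
    Tendsto (fun m : ℕ => Real.log m / Real.log (m + 1 : ℕ)) atTop (nhds 1) := by
  have hlog : Tendsto (fun n : ℕ => Real.log (n + 1 : ℕ)) atTop atTop :=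
    (tendsto_add_atTop_iff_nat 1).2 (Real.tendsto_log_atTop.comp tendsto_natCast_atTop_atTop)
  have h1 := (Real.tendsto_log_nat_add_one_sub_log.div_atTop (by simpa using hlog)).const_sub 1
  rw [sub_zero] at h1
  refine h1.congr' ?_
  filter_upwards [hlog.eventually_gt_atTop 0] with n hn
  push_cast at hn ⊢
  field_simp
  ring

theorem tendsto_sub_div_log_sq_mul_log_sq :
    Tendsto (fun m : ℕ => (((m + 1 : ℕ) : ℝ) / Real.log (m + 1 : ℕ) ^ 2 - m / Real.log m ^ 2) *
      Real.log m ^ 2) atTop (nhds 1) := by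
  have hlog0 : Tendsto (fun n : ℕ => Real.log n) atTop atTop :=
    Real.tendsto_log_atTop.comp tendsto_natCast_atTop_atTop
  have hlog : Tendsto (fun n : ℕ => Real.log (n + 1 : ℕ)) atTop atTop :=
    (tendsto_add_atTop_iff_nat 1).2 hlog0
  have hr := tendsto_log_div_log_succ
  have h1 : Tendsto (fun m : ℕ => (1 + Real.log m / Real.log (m + 1 : ℕ)) / Real.log (m + 1 : ℕ))
      atTop (nhds 0) := (hr.const_add 1).div_atTop hlog
  have h2 : Tendsto (fun m : ℕ => (m : ℝ) * (Real.log (m + 1 : ℕ) - Real.log m) *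
      ((1 + Real.log m / Real.log (m + 1 : ℕ)) / Real.log (m + 1 : ℕ))) atTop (nhds 0) := by
    refine squeeze_zero' ?_ ?_ h1
    · filter_upwards [eventually_ge_atTop 1] with m hm
      have hm' : (1 : ℝ) ≤ m := by exact_mod_cast hm
      have h0 : 0 ≤ Real.log m := Real.log_nonneg hm'
      have h3 : Real.log m ≤ Real.log (m + 1 : ℕ) :=
        Real.log_le_log (by positivity) (by push_cast; linarith)
      have h4 := h0.trans h3
      have h5 := sub_nonneg.2 h3
      positivity
    · filter_upwards [eventually_ge_atTop 1] with m hm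
      have hm' : (1 : ℝ) ≤ m := by exact_mod_cast hm
      have h0 : 0 ≤ Real.log m := Real.log_nonneg hm'
      have h3 : 0 ≤ Real.log (m + 1 : ℕ) := Real.log_nonneg (by push_cast; linarith)
      refine mul_le_of_le_one_left (by positivity) ?_
      rw [← Real.log_div (by positivity) (by positivity)]
      have h4 := Real.log_le_sub_one_of_pos (x := ((m + 1 : ℕ) : ℝ) / m) (by positivity)
      calc _ ≤ (m : ℝ) * (((m + 1 : ℕ) : ℝ) / m - 1) := by gcongr
        _ = 1 := by push_cast; field_simp; ring
  have h3 := (hr.pow 2).sub h2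
  rw [one_pow, sub_zero] at h3
  refine h3.congr' ?_
  filter_upwards [hlog0.eventually_gt_atTop 0, hlog.eventually_gt_atTop 0] with m h4 h5
  push_cast at h5 ⊢
  field_simp
  ring

theorem rpow_isLittleO_div_log_sq :
    (fun n : ℕ => ((n : ℝ) + 1) ^ (3 / 4 : ℝ)) =o[atTop]
      fun n : ℕ => ((n + 1 : ℕ) : ℝ) / Real.log (n + 1 : ℕ) ^ 2 := by
  have h1 : (fun x : ℝ => x ^ (3 / 4 : ℝ)) =o[atTop] fun x => x / Real.log x ^ 2 := by
    have h2 := (isBigO_refl (fun x : ℝ => x ^ (3 / 4 : ℝ) / Real.log x ^ 2) atTop).mul_isLittleO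
      (isLittleO_log_rpow_rpow_atTop 2 (show (0 : ℝ) < 1 / 4 by norm_num))
    refine h2.congr' ?_ ?_
    · filter_upwards [Real.tendsto_log_atTop.eventually_gt_atTop 0] with x hx
      rw [Real.rpow_two]
      field_simp
    · filter_upwards [eventually_gt_atTop 0] with x hx
      rw [div_mul_eq_mul_div, ← Real.rpow_add hx]
      norm_num
  simpa [Function.comp_def] using h1.comp_tendsto
    ((tendsto_add_atTop_iff_nat 1).2 (tendsto_natCast_atTop_atTop (R := ℝ)))

theorem isEquivalent_sum_sq_of_tendsto_mul_log {Y : ℕ → ℝ}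
    (hY : Tendsto (fun m : ℕ => Y m * Real.log m) atTop (nhds 1)) :
    (fun n => ∑ i ∈ range n, Y (2 + i) ^ 2) ~[atTop]
      fun n : ℕ => ((n + 1 : ℕ) : ℝ) / Real.log (n + 1 : ℕ) ^ 2 := by
  set b : ℕ → ℝ := fun m => (m : ℝ) / Real.log m ^ 2 with hb
  have hlog0 : Tendsto (fun n : ℕ => Real.log n) atTop atTop :=
    Real.tendsto_log_atTop.comp tendsto_natCast_atTop_atTop
  have hev : ∀ᶠ m : ℕ in atTop, 1 / (m : ℝ) ≤ Y m ^ 2 := by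
    have h1 := (Real.isLittleO_pow_log_id_atTop (n := 2)).comp_tendsto
      (tendsto_natCast_atTop_atTop (R := ℝ))
    filter_upwards [hY.eventually_const_lt (show (1 / 2 : ℝ) < 1 by norm_num),
      h1.bound (show (0 : ℝ) < 1 / 4 by norm_num), eventually_gt_atTop 0] with m h2 h3 h4
    have h5 : (0 : ℝ) < m := by exact_mod_cast h4
    simp only [Function.comp_apply, id, norm_pow, Real.norm_eq_abs, sq_abs, abs_of_pos h5] at h3
    rw [div_le_iff₀ h5]
    have h6 : (1 / 2) ^ 2 ≤ (Y m * Real.log m) ^ 2 := pow_le_pow_left₀ (by norm_num) h2.le 2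
    rw [mul_pow] at h6
    nlinarith [mul_le_mul_of_nonneg_left h3 (sq_nonneg (Y m))]
  have hns : ¬ Summable fun i => Y (2 + i) ^ 2 := by
    intro hs
    simp only [add_comm 2] at hs
    have hs' := (summable_nat_add_iff (f := fun m => Y m ^ 2) 2).1 hs
    refine Real.not_summable_one_div_natCast (summable_of_isBigO_nat hs' ?_)
    refine IsBigO.of_bound 1 ?_
    filter_upwards [hev] with m hm
    rw [Real.norm_of_nonneg (by positivity), Real.norm_of_nonneg (by positivity), one_mul]
    exact hm
  have htop := (not_summable_iff_tendsto_nat_atTop_of_nonneg fun i => sq_nonneg (Y (2 + i))).1 hns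
  have hequiv : (fun i => b (i + 1 + 1) - b (i + 1)) ~[atTop] fun i => Y (2 + i) ^ 2 := by
    have h1 : Tendsto (fun m : ℕ => (Y (m + 1) * Real.log m) ^ 2) atTop (nhds 1) := by
      have h2 := ((tendsto_add_atTop_iff_nat 1).2 hY).mul tendsto_log_div_log_succ
      have h3 := h2.pow 2
      rw [one_mul, one_pow] at h3
      refine h3.congr' ?_
      filter_upwards [((tendsto_add_atTop_iff_nat 1).2 hlog0).eventually_gt_atTop 0] with m hm
      rw [mul_assoc, mul_div_cancel₀ _ hm.ne']
    have h4 := tendsto_sub_div_log_sq_mul_log_sq.div h1 one_ne_zero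
    rw [div_one] at h4
    refine isEquivalent_of_tendsto_one (((tendsto_add_atTop_iff_nat 1).2 h4).congr' ?_)
    filter_upwards [((tendsto_add_atTop_iff_nat 1).2 hlog0).eventually_gt_atTop 0] with m hm
    simp only [Pi.div_apply]
    rw [mul_pow, mul_div_mul_right _ _ (pow_pos hm 2).ne', show 2 + m = m + 1 + 1 by ring]
  have hsum := hequiv.isLittleO.sum_range (fun i => sq_nonneg _) htop
  simp only [Pi.sub_apply, sum_sub_distrib] at hsum
  have hb1 : ∀ n, ∑ i ∈ range n, b (i + 1 + 1) - ∑ i ∈ range n, b (i + 1) = b (n + 1) := by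
    intro n
    rw [← sum_sub_distrib, sum_range_sub fun i => b (i + 1)]
    simp [hb]
  simp only [hb1] at hsum
  exact IsEquivalent.symm hsum

theorem piTwin_succ {A : Set ℕ} (hA : ∀ n ∈ A, 2 ≤ n) (k n : ℕ) :
    (piTwin A k (n + 1) : ℝ) =
      ∑ i ∈ range n, memInd A (2 + i) * memInd A (2 + k + i) := by
  have h0 : memInd A 0 = 0 := if_neg fun h => by simpa using hA 0 h
  have h1 : memInd A 1 = 0 := if_neg fun h => by simpa using hA 1 h
  have h2 : (piTwin A k (n + 1) : ℝ) =
      ∑ m ∈ range (2 + n), memInd A m * memInd A (m + k) := by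
    rw [piTwin, card_filter, show n + 1 + 1 = 2 + n by ring]
    push_cast
    refine sum_congr rfl fun m _ => ?_
    unfold memInd
    split_ifs <;> simp_all
  rw [h2, sum_range_add]
  simp [sum_range_succ, h0, h1, add_right_comm]

theorem isLittleO_sum_hawkinsY_sub_mul {A : Set ℕ} (hA : ∀ n ∈ A, 2 ≤ n) (k : ℕ) :
    (fun n => ∑ i ∈ range n,
      (hawkinsY A (2 + k + i) - hawkinsY A (2 + i)) * memInd A (2 + i)) =o[atTop]
        fun n : ℕ => ((n : ℝ) + 1) ^ (3 / 4 : ℝ) := by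
  have hs : Summable fun i : ℕ => (k : ℝ) * ((i : ℝ) + 1) ^ (-(7 / 4) : ℝ) := by
    have := (Real.summable_nat_rpow (p := -(7 / 4))).2 (by norm_num)
    simpa using ((summable_nat_add_iff 1).2 this).mul_left (k : ℝ)
  have key : Summable fun i : ℕ => (hawkinsY A (2 + k + i) - hawkinsY A (2 + i)) *
      memInd A (2 + i) / ((i : ℝ) + 1) ^ (3 / 4 : ℝ) := by
    refine Summable.of_norm_bounded hs fun i => ?_
    have h0 : (0 : ℝ) < i + 1 := by positivity
    have h1 := hawkinsY_sub_le hA (show 0 < 2 + i by omega) k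
    have h2 := hawkinsY_antitone hA (show 2 + i ≤ 2 + i + k by omega)
    rw [add_right_comm] at h1 h2
    have h3 : (k : ℝ) / (2 + i : ℕ) ≤ k / (i + 1) := by
      gcongr
      push_cast
      linarith
    rw [norm_div, norm_mul, Real.norm_of_nonneg (memInd_nonneg _ _), norm_sub_rev,
      Real.norm_of_nonneg (by linarith), Real.norm_of_nonneg (by positivity)]
    have h4 : ((i : ℝ) + 1) ^ (-(7 / 4) : ℝ) = (i + 1 : ℝ)⁻¹ / (i + 1 : ℝ) ^ (3 / 4 : ℝ) := by
      rw [← Real.rpow_neg_one, ← Real.rpow_sub h0]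
      norm_num
    rw [h4, ← mul_div_assoc, ← div_eq_mul_inv]
    gcongr
    exact (mul_le_of_le_one_right (by linarith) (memInd_le_one _ _)).trans (by linarith)
  refine isLittleO_sum_of_tendsto_sum_div (fun i j hij => ?_) (fun n => by positivity) ?_
    key.hasSum.tendsto_sum_nat
  · have : (i : ℝ) ≤ j := by exact_mod_cast hij
    exact Real.rpow_le_rpow (by positivity) (by linarith) (by norm_num)
  · exact (tendsto_rpow_atTop (by norm_num)).comp
      (tendsto_atTop_add_const_right _ _ tendsto_natCast_atTop_atTop)

theorem twin_primes_hawkins (k : ℕ) (hk : 0 < k) {Ω : Type*} [MeasurableSpace Ω]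
    (μ : Measure Ω) (α : Ω → Set ℕ) (h : IsHawkinsSieve μ α) :
    ∀ᵐ ω ∂μ, Tendsto
      (fun x : ℕ => (piTwin (α ω) k x : ℝ) / ((x : ℝ) / (Real.log x) ^ 2))
      atTop (nhds 1) := by
  have hE1 := h.ae_isLittleO_sum (s := 2 + k) (by omega)
    (g := fun i ω => memInd (α ω) (2 + i))
    (fun i => h.stronglyMeasurable_memInd (by omega))
    (fun i ω => by rw [abs_of_nonneg (memInd_nonneg _ _)]; exact memInd_le_one _ _)
  have hE3 := h.ae_isLittleO_sum le_rfl
    (g := fun i ω => hawkinsY (α ω) (2 + i))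
    (fun i => h.stronglyMeasurable_hawkinsY _)
    (fun i ω => by
      rw [abs_of_pos (hawkinsY_pos (h.mem_ge_two ω) _)]
      exact hawkinsY_le_one (h.mem_ge_two ω) _)
  filter_upwards [hE1, hE3, h.ae_tendsto_hawkinsY_mul_log] with ω h1 h3 hY
  have hA := h.mem_ge_two ω
  have h2 := isLittleO_sum_hawkinsY_sub_mul hA k
  have h4 := isEquivalent_sum_sq_of_tendsto_mul_log hY
  have h5 := h4.add_isLittleO (((h1.add h2).add h3).trans rpow_isLittleO_div_log_sq)
  have h6 : (fun n : ℕ => (piTwin (α ω) k (n + 1) : ℝ)) ~[atTop]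
      fun n : ℕ => ((n + 1 : ℕ) : ℝ) / Real.log (n + 1 : ℕ) ^ 2 := by
    refine h5.congr_left (Eventually.of_forall fun n => ?_)
    simp only [Pi.add_apply]
    rw [piTwin_succ hA, ← sum_add_distrib, ← sum_add_distrib, ← sum_add_distrib]
    exact sum_congr rfl fun i _ => by ring
  have h7 : ∀ᶠ n : ℕ in atTop, ((n + 1 : ℕ) : ℝ) / Real.log (n + 1 : ℕ) ^ 2 ≠ 0 := by
    filter_upwards [eventually_gt_atTop 0] with n hn
    have : 0 < Real.log (n + 1 : ℕ) := Real.log_pos (by exact_mod_cast Nat.lt_add_of_pos_left hn)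
    positivity
  exact (tendsto_add_atTop_iff_nat 1).1 ((isEquivalent_iff_tendsto_one h7).1 h6)
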